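/- Let q ∈ ℂ× and z₁, z₂, z₃ ∈ ℂ. For every choice of X, Y, Z ∈ {Γ, Δ}, the Yang–Baxter equation (R_{YZ}(z₂,z₃)⊗I) ∘ (I⊗R_{XZ}(z₁,z₃)) ∘ (R_{XY}(z₁,z₂)⊗I) = (I⊗R_{XY}(z₁,z₂)) ∘ (R_{XZ}(z₁,z₃)⊗I) ∘ (I⊗R_{YZ}(z₂,z₃)) holds as an identity of endomorphisms of ℂ²⊗ℂ²⊗ℂ² (eight equations in total, one for each triple (X,Y,Z)). -/

import Mathlib

open Matrix

/-- The endomorphism of `ℂ²⊗ℂ²` with Boltzmann weights `(a₁,a₂,b₁,b₂,c₁,c₂)`,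
in the ordered basis `e₀⊗e₀, e₀⊗e₁, e₁⊗e₀, e₁⊗e₁` (columns are images of basis vectors). -/
def Mmat (a₁ a₂ b₁ b₂ c₁ c₂ : ℂ) : Matrix (Fin 4) (Fin 4) ℂ :=
  !![a₂, 0,  0,  0;
     0,  c₂, b₁, 0;
     0,  b₂, c₁, 0;
     0,  0,  0,  a₁]

/-- The R-matrix `R(ζ,ζ')`. -/
def Rmat (ζ ζ' : ℂ) : Matrix (Fin 4) (Fin 4) ℂ :=
  Mmat (-(ζ * ζ')) 1 ζ' ζ (1 - ζ ^ 2) 0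

/-- The R-matrix `R'(ζ,ζ')`. -/
def Rmat' (ζ ζ' : ℂ) : Matrix (Fin 4) (Fin 4) ℂ :=
  Mmat 1 (-(ζ * ζ')) (-ζ) (-ζ') 0 (1 - ζ' ^ 2)

/-- `A ⊗ I` : the Kronecker product of a `4×4` matrix (acting on the first two tensor
factors of `ℂ²⊗ℂ²⊗ℂ²`) with the `2×2` identity, indexed by `Fin 8`
(basis index `i ↔ e_{i/4} ⊗ e_{(i/2)%2} ⊗ e_{i%2}`). -/
def tenL (A : Matrix (Fin 4) (Fin 4) ℂ) : Matrix (Fin 8) (Fin 8) ℂ :=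
  Matrix.of fun i j =>
    A ⟨i.val / 2, by have := i.isLt; omega⟩ ⟨j.val / 2, by have := j.isLt; omega⟩ *
      (if i.val % 2 = j.val % 2 then 1 else 0)

/-- `I ⊗ A` : the Kronecker product of the `2×2` identity with a `4×4` matrix acting on
the last two tensor factors of `ℂ²⊗ℂ²⊗ℂ²`, indexed by `Fin 8`. -/
def tenR (A : Matrix (Fin 4) (Fin 4) ℂ) : Matrix (Fin 8) (Fin 8) ℂ :=
  Matrix.of fun i j =>
    (if i.val / 4 = j.val / 4 then 1 else 0) *
      A ⟨i.val % 4, by have := i.isLt; omega⟩ ⟨j.val % 4, by have := j.isLt; omega⟩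
/-- Γ Tokuyama T-weights (deformation parameter `v = q²`). -/
noncomputable def TG (q z : ℂ) : Matrix (Fin 4) (Fin 4) ℂ :=
  Mmat 1 z (-q) (q * z) ((1 - q ^ 2) * z) 1

/-- Δ Tokuyama T-weights (deformation parameter `v = q²`). -/
noncomputable def TD (q z : ℂ) : Matrix (Fin 4) (Fin 4) ℂ :=
  Mmat 1 (-(q ^ 2 * z)) q⁻¹ (q * z) ((1 - q ^ 2) * z) 1

/-- ΓΓ Tokuyama R-weights. -/
noncomputable def RGG (q z₁ z₂ : ℂ) : Matrix (Fin 4) (Fin 4) ℂ :=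
  Mmat (z₂ - q ^ 2 * z₁) (z₁ - q ^ 2 * z₂) (q * (z₁ - z₂)) (q * (z₁ - z₂))
    ((1 - q ^ 2) * z₁) ((1 - q ^ 2) * z₂)

/-- ΔΔ Tokuyama R-weights. -/
noncomputable def RDD (q z₁ z₂ : ℂ) : Matrix (Fin 4) (Fin 4) ℂ :=
  Mmat (z₁ - q ^ 2 * z₂) (z₂ - q ^ 2 * z₁) (q * (z₁ - z₂)) (q * (z₁ - z₂))
    ((1 - q ^ 2) * z₁) ((1 - q ^ 2) * z₂)

/-- ΓΔ Tokuyama R-weights. -/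
noncomputable def RGD (q z₁ z₂ : ℂ) : Matrix (Fin 4) (Fin 4) ℂ :=
  Mmat (z₁ - q ^ 2 * z₂) (z₁ - q ^ 2 * z₂) (q⁻¹ * (q ^ 4 * z₂ - z₁)) (q * (z₁ - z₂))
    ((1 - q ^ 2) * z₁) ((1 - q ^ 2) * z₂)

/-- ΔΓ Tokuyama R-weights. -/
noncomputable def RDG (q z₁ z₂ : ℂ) : Matrix (Fin 4) (Fin 4) ℂ :=
  Mmat (z₂ - q ^ 2 * z₁) (z₂ - q ^ 2 * z₁) (q⁻¹ * (z₂ - q ^ 4 * z₁)) (q * (z₁ - z₂))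
    ((1 - q ^ 2) * z₁) ((1 - q ^ 2) * z₂)

/-- The Tokuyama T-weights indexed by type `X ∈ {Γ, Δ}` (`true = Γ`, `false = Δ`). -/
noncomputable def Ttok (q : ℂ) : Bool → ℂ → Matrix (Fin 4) (Fin 4) ℂ
  | true => TG q
  | false => TD q

/-- The Tokuyama R-weights indexed by types `X, Y ∈ {Γ, Δ}` (`true = Γ`, `false = Δ`). -/
noncomputable def Rtok (q : ℂ) : Bool → Bool → ℂ → ℂ → Matrix (Fin 4) (Fin 4) ℂ
  | true, true => RGG q
  | false, false => RDD q
  | true, false => RGD q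
  | false, true => RDG q

/-- The Yang–Baxter equation on a three-dimensional weight space, where the weights
`(a, c₂, b₁, b₂, c₁)` of the three matrices are `(a, p, r, s, t)`, `(a', …, t')`, `(a'', …, t'')`.
The two entries that agree identically are omitted. -/
def WeightSpaceYBE (a p r s t a' p' r' s' t' a'' p'' r'' s'' t'' : ℂ) : Prop :=
  a * p' * a'' = p'' * a' * p + r'' * p' * s ∧
  a * r' * p'' = p'' * a' * r + r'' * p' * t ∧
  p * s' * a'' = s'' * a' * p + t'' * p' * s ∧
  p * t' * p'' + r * a' * s'' = s'' * a' * r + t'' * p' * t ∧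
  p * t' * r'' + r * a' * t'' = t'' * r' * a ∧
  s * t' * p'' + t * a' * s'' = a'' * s' * t ∧
  s * t' * r'' + t * a' * t'' = a'' * t' * a

lemma tenL_Mmat (a₁ a₂ b₁ b₂ c₁ c₂ : ℂ) :
    tenL (Mmat a₁ a₂ b₁ b₂ c₁ c₂) =
      !![a₂, 0, 0, 0, 0, 0, 0, 0;
         0, a₂, 0, 0, 0, 0, 0, 0;
         0, 0, c₂, 0, b₁, 0, 0, 0;
         0, 0, 0, c₂, 0, b₁, 0, 0;
         0, 0, b₂, 0, c₁, 0, 0, 0;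
         0, 0, 0, b₂, 0, c₁, 0, 0;
         0, 0, 0, 0, 0, 0, a₁, 0;
         0, 0, 0, 0, 0, 0, 0, a₁] := by
  ext i j
  fin_cases i <;> fin_cases j <;> simp [tenL, Mmat]

lemma tenR_Mmat (a₁ a₂ b₁ b₂ c₁ c₂ : ℂ) :
    tenR (Mmat a₁ a₂ b₁ b₂ c₁ c₂) =
      !![a₂, 0, 0, 0, 0, 0, 0, 0;
         0, c₂, b₁, 0, 0, 0, 0, 0;
         0, b₂, c₁, 0, 0, 0, 0, 0;
         0, 0, 0, a₁, 0, 0, 0, 0;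
         0, 0, 0, 0, a₂, 0, 0, 0;
         0, 0, 0, 0, 0, c₂, b₁, 0;
         0, 0, 0, 0, 0, b₂, c₁, 0;
         0, 0, 0, 0, 0, 0, 0, a₁] := by
  ext i j
  fin_cases i <;> fin_cases j <;> simp [tenR, Mmat]

set_option maxHeartbeats 2000000 in
/-- The Yang–Baxter equation for six-vertex matrices follows from its restrictions to the two
three-dimensional weight spaces. On the second one the outer matrices change roles. -/
lemma tenL_mul_tenR_mul_tenL_of_weightSpaceYBE
    {a₁ a₂ b₁ b₂ c₁ c₂ a₁' a₂' b₁' b₂' c₁' c₂' a₁'' a₂'' b₁'' b₂'' c₁'' c₂'' : ℂ}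
    (h₁ : WeightSpaceYBE a₂ c₂ b₁ b₂ c₁ a₂' c₂' b₁' b₂' c₁' a₂'' c₂'' b₁'' b₂'' c₁'')
    (h₂ : WeightSpaceYBE a₁'' c₂'' b₁'' b₂'' c₁'' a₁' c₂' b₁' b₂' c₁' a₁ c₂ b₁ b₂ c₁) :
    tenL (Mmat a₁ a₂ b₁ b₂ c₁ c₂) * tenR (Mmat a₁' a₂' b₁' b₂' c₁' c₂') *
        tenL (Mmat a₁'' a₂'' b₁'' b₂'' c₁'' c₂'') =
      tenR (Mmat a₁'' a₂'' b₁'' b₂'' c₁'' c₂'') * tenL (Mmat a₁' a₂' b₁' b₂' c₁' c₂') *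
        tenR (Mmat a₁ a₂ b₁ b₂ c₁ c₂) := by
  obtain ⟨h₁₁, h₁₂, h₁₃, h₁₄, h₁₅, h₁₆, h₁₇⟩ := h₁
  obtain ⟨h₂₁, h₂₂, h₂₃, h₂₄, h₂₅, h₂₆, h₂₇⟩ := h₂
  simp only [tenL_Mmat, tenR_Mmat]
  ext i j
  fin_cases i <;> fin_cases j <;> simp [Matrix.mul_apply, Fin.sum_univ_eight] <;> grind

theorem stmt16 (q z₁ z₂ z₃ : ℂ) (hq : q ≠ 0) :
    ∀ X Y Z : Bool,
      tenL (Rtok q Y Z z₂ z₃) * tenR (Rtok q X Z z₁ z₃) * tenL (Rtok q X Y z₁ z₂) =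
        tenR (Rtok q X Y z₁ z₂) * tenL (Rtok q X Z z₁ z₃) * tenR (Rtok q Y Z z₂ z₃) := by
  intro X Y Z
  cases X <;> cases Y <;> cases Z <;>
    refine tenL_mul_tenR_mul_tenL_of_weightSpaceYBE ?_ ?_ <;>
    refine ⟨?_, ?_, ?_, ?_, ?_, ?_, ?_⟩ <;> field_simp <;> ring
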